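/- z_2(24) = 122: there exists a 24×24 (0,1)-matrix with 122 ones containing no all-one 2×2 minor, and every 24×24 (0,1)-matrix containing no all-one 2×2 minor has at most 122 ones. -/

import Mathlib

/-- An `m × n` (0,1)-matrix (entries as `Bool`) is `(a,b)`-admissible if it contains no
all-one `a × b` minor. -/
def Admissible {m n : ℕ} (a b : ℕ) (M : Fin m → Fin n → Bool) : Prop :=
  ¬ ∃ (R : Finset (Fin m)) (C : Finset (Fin n)),
      R.card = a ∧ C.card = b ∧ ∀ i ∈ R, ∀ j ∈ C, M i j = true

/-- The number of ones in a (0,1)-matrix. -/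
def onesCount {m n : ℕ} (M : Fin m → Fin n → Bool) : ℕ :=
  (Finset.univ.filter fun p : Fin m × Fin n => M p.1 p.2 = true).card

set_option linter.unusedSectionVars false

open Finset

section PartialPlane

variable {α β : Type} [Fintype α] [Fintype β]

/-- A `{0,1}`-valued point-line incidence function in which two points share at most one line. -/
structure IsPartialPlane (x : α → β → ℤ) : Prop where
  zero_or_one : ∀ p l, x p l = 0 ∨ x p l = 1
  rect : ∀ p q l l', p ≠ q → l ≠ l' → x p l * x q l * (x p l' * x q l') = 0

/-- By how much the degree of a point exceeds `5`. -/
def excess (x : α → β → ℤ) (p : α) : ℤ := ∑ l, x p l - 5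

/-- By how much the size of a line falls short of `5`. -/
def defect (x : α → β → ℤ) (l : β) : ℤ := 5 - ∑ p, x p l

/-- The total excess of the points on a line. -/
def load (x : α → β → ℤ) (l : β) : ℤ := ∑ p, excess x p * x p l

/-- The total defect of the lines through a point. -/
def weight (x : α → β → ℤ) (p : α) : ℤ := ∑ l, x p l * defect x l

lemma sum_le_one_of_mul_eq_zero {y : β → ℤ} (h01 : ∀ l, y l = 0 ∨ y l = 1)
    (h : ∀ l l', l ≠ l' → y l * y l' = 0) : ∑ l, y l ≤ 1 := by
  by_cases h0 : ∀ l, y l = 0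
  · simp [h0]
  · push Not at h0
    obtain ⟨l, hl⟩ := h0
    rw [Finset.sum_eq_single l]
    · rcases h01 l with h' | h' <;> omega
    · intro l' _ hne
      exact (mul_eq_zero.1 (h l l' hne.symm)).resolve_left hl
    · simp

namespace IsPartialPlane

variable {x : α → β → ℤ}

lemma nonneg (h : IsPartialPlane x) (p : α) (l : β) : 0 ≤ x p l := by
  rcases h.zero_or_one p l with h | h <;> omega

lemma mul_self (h : IsPartialPlane x) (p : α) (l : β) : x p l * x p l = x p l := by
  rcases h.zero_or_one p l with h | h <;> simp [h]

lemma transpose (h : IsPartialPlane x) : IsPartialPlane fun l p => x p l where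
  zero_or_one l p := h.zero_or_one p l
  rect l l' p q hl hp := by
    have := h.rect p q l l' hp hl
    linear_combination this

lemma sum_mul_le_one (h : IsPartialPlane x) {p q : α} (hpq : p ≠ q) :
    ∑ l, x p l * x q l ≤ 1 := by
  refine sum_le_one_of_mul_eq_zero (fun l => ?_) fun l l' hl => h.rect p q l l' hpq hl
  rcases h.zero_or_one p l with h1 | h1 <;> rcases h.zero_or_one q l with h2 | h2 <;> simp [h1, h2]

lemma sum_mul_sum_le (h : IsPartialPlane x) {c : α → ℤ} (hc : ∀ q, 0 ≤ c q) (p : α) :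
    ∑ l, x p l * ∑ q, c q * x q l ≤ c p * ∑ l, x p l + (∑ q, c q - c p) := by
  classical
  have e : ∑ l, x p l * ∑ q, c q * x q l = ∑ q, c q * ∑ l, x p l * x q l := by
    simp_rw [Finset.mul_sum]
    rw [Finset.sum_comm]
    exact Finset.sum_congr rfl fun q _ => Finset.sum_congr rfl fun l _ => by ring
  rw [e, ← Finset.add_sum_erase univ _ (mem_univ p), ← Finset.add_sum_erase univ c (mem_univ p)]
  have h1 : ∑ l, x p l * x p l = ∑ l, x p l := Finset.sum_congr rfl fun l _ => h.mul_self p l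
  have h2 : ∑ q ∈ univ.erase p, c q * ∑ l, x p l * x q l ≤ ∑ q ∈ univ.erase p, c q :=
    Finset.sum_le_sum fun q hq =>
      mul_le_of_le_one_right (hc q) (h.sum_mul_le_one (Finset.ne_of_mem_erase hq).symm)
  rw [h1]
  linarith

lemma sum_mul_size_le (h : IsPartialPlane x) (p : α) :
    ∑ l, x p l * ∑ q, x q l ≤ ∑ l, x p l + (Fintype.card α - 1) := by
  simpa using h.sum_mul_sum_le (c := fun _ => 1) (fun _ => by norm_num) p

lemma restrict (h : IsPartialPlane x) {c : α → ℤ} (hc : ∀ p, c p = 0 ∨ c p = 1) :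
    IsPartialPlane fun p l => c p * x p l where
  zero_or_one p l := by
    rcases hc p with h1 | h1 <;> rcases h.zero_or_one p l with h2 | h2 <;> simp [h1, h2]
  rect p q l l' hp hl := by
    have := h.rect p q l l' hp hl
    linear_combination (c p * c q * c p * c q) * this

/-- Incidences can be deleted to reach any smaller total. -/
lemma exists_total_eq (h : IsPartialPlane x) {e : ℕ} (he : (e : ℤ) ≤ ∑ p, ∑ l, x p l) :
    ∃ y : α → β → ℤ, IsPartialPlane y ∧ ∑ p, ∑ l, y p l = e := by
  classical
  set E : Finset (α × β) := univ.filter fun z => x z.1 z.2 = 1 with hE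
  have hx : ∀ p l, x p l = if (p, l) ∈ E then 1 else 0 := fun p l => by
    rcases h.zero_or_one p l with h1 | h1 <;> simp [hE, h1]
  have tot : ∀ F : Finset (α × β), ∑ p, ∑ l, (if (p, l) ∈ F then (1 : ℤ) else 0) = F.card := by
    intro F
    rw [← Fintype.sum_prod_type' (f := fun p l => if (p, l) ∈ F then (1 : ℤ) else 0)]
    simp
  have hcard : e ≤ E.card := by
    simp_rw [hx, tot] at he
    exact_mod_cast he
  obtain ⟨F, hFE, hF⟩ := Finset.exists_subset_card_eq hcard
  refine ⟨fun p l => if (p, l) ∈ F then 1 else 0, ⟨fun p l => ?_, fun p q l l' hp hl => ?_⟩, ?_⟩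
  · by_cases hm : (p, l) ∈ F <;> simp [hm]
  · have := h.rect p q l l' hp hl
    simp only [hx] at this
    by_contra hne
    simp only [mul_eq_zero, ite_eq_right_iff, one_ne_zero, imp_false, not_or, not_not] at hne
    simp [hFE hne.1.1, hFE hne.1.2, hFE hne.2.1, hFE hne.2.2] at this
  · rw [tot, hF]

end IsPartialPlane

lemma sum_mul_sum_comm (c : α → ℤ) (d : β → ℤ) (x : α → β → ℤ) :
    ∑ l, d l * ∑ p, c p * x p l = ∑ p, c p * ∑ l, x p l * d l := by
  simp_rw [Finset.mul_sum]
  rw [Finset.sum_comm]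
  exact Finset.sum_congr rfl fun q _ => Finset.sum_congr rfl fun l _ => by ring

/-- A partial plane with `27 - A` points, `24` lines and `135 - 4 * A` incidences, all of whose
points have degree at least `5`. -/
structure IsDensePlane (x : α → β → ℤ) (A : ℤ) : Prop extends IsPartialPlane x where
  card_points : (Fintype.card α : ℤ) = 27 - A
  card_lines : Fintype.card β = 24
  total : ∑ p, ∑ l, x p l = 135 - 4 * A
  excess_nonneg : ∀ p, 0 ≤ excess x p

namespace IsDensePlane

variable {x : α → β → ℤ} {A : ℤ}

lemma degree (p : α) : ∑ l, x p l = 5 + excess x p := by simp [excess]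

lemma size (l : β) : ∑ p, x p l = 5 - defect x l := by simp [defect]

lemma sum_excess (h : IsDensePlane x A) : ∑ p, excess x p = A := by
  simp only [excess, Finset.sum_sub_distrib, h.total]
  simp [h.card_points]
  ring

lemma sum_defect (h : IsDensePlane x A) : ∑ l, defect x l = 4 * A - 15 := by
  simp only [defect, Finset.sum_sub_distrib]
  rw [Finset.sum_comm, h.total]
  simp [h.card_lines]
  ring

lemma load_nonneg (h : IsDensePlane x A) (l : β) : 0 ≤ load x l :=
  Finset.sum_nonneg fun p _ => mul_nonneg (h.excess_nonneg p) (h.nonneg p l)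

lemma sum_mul_degree (l : β) : ∑ p, x p l * ∑ l', x p l' = 5 * (5 - defect x l) + load x l := by
  rw [← size (x := x), load, Finset.mul_sum, ← Finset.sum_add_distrib]
  exact Finset.sum_congr rfl fun p _ => by rw [degree]; ring

lemma load_le (h : IsDensePlane x A) (l : β) : load x l ≤ 3 + 4 * defect x l := by
  have h1 := h.transpose.sum_mul_size_le l
  simp only [sum_mul_degree, size, h.card_lines] at h1
  push_cast at h1
  linarith

lemma defect_nonneg (h : IsDensePlane x A) (l : β) : 0 ≤ defect x l := by
  have h1 := h.load_le l
  have h2 := h.load_nonneg l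
  omega

lemma le_weight (h : IsDensePlane x A) (p : α) : 4 * excess x p + A - 6 ≤ weight x p := by
  have h1 := h.sum_mul_size_le p
  simp only [size, degree, h.card_points, mul_sub, Finset.sum_sub_distrib, ← Finset.sum_mul] at h1
  rw [weight]
  linarith

lemma weight_le (h : IsDensePlane x A) (p : α) : weight x p ≤ 4 * A - 15 := by
  rw [← h.sum_defect, weight]
  refine Finset.sum_le_sum fun l _ => ?_
  have := h.defect_nonneg l
  rcases h.zero_or_one p l with h1 | h1 <;> simp [h1, this]

lemma sum_load : ∑ l, load x l = ∑ p, excess x p * (5 + excess x p) := by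
  have := sum_mul_sum_comm (excess x) (fun _ => 1) x
  simpa [load, degree] using this

lemma sum_defect_mul_load : ∑ l, defect x l * load x l = ∑ p, excess x p * weight x p :=
  sum_mul_sum_comm (excess x) (defect x) x

lemma sum_load_sq : ∑ l, load x l ^ 2 = ∑ p, excess x p * ∑ l, x p l * load x l := by
  rw [← sum_mul_sum_comm (excess x) (load x) x]
  exact Finset.sum_congr rfl fun l _ => by rw [sq]; rfl

lemma sum_mul_load_le (h : IsDensePlane x A) (p : α) :
    ∑ l, x p l * load x l ≤ excess x p * (4 + excess x p) + A := by
  have := h.sum_mul_sum_le h.excess_nonneg p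
  rw [h.sum_excess, degree] at this
  unfold load
  linarith

lemma sum_load_sq_le (h : IsDensePlane x A) :
    ∑ l, load x l ^ 2 ≤ ∑ p, excess x p * (excess x p * (4 + excess x p)) + A ^ 2 := by
  have : ∑ l, load x l ^ 2 ≤ ∑ p, excess x p * (excess x p * (4 + excess x p) + A) := by
    rw [sum_load_sq]
    exact Finset.sum_le_sum fun p _ =>
      mul_le_mul_of_nonneg_left (h.sum_mul_load_le p) (h.excess_nonneg p)
  simp only [mul_add _ _ A, Finset.sum_add_distrib, ← Finset.sum_mul, h.sum_excess] at this
  linarith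

lemma le_sum_defect_mul_load (h : IsDensePlane x A) :
    ∑ p, excess x p * (4 * excess x p + A - 6) ≤ ∑ l, defect x l * load x l := by
  rw [sum_defect_mul_load]
  exact Finset.sum_le_sum fun p _ =>
    mul_le_mul_of_nonneg_left (h.le_weight p) (h.excess_nonneg p)

lemma sum_defect_sq_le (h : IsDensePlane x A) :
    ∑ l, defect x l ^ 2 ≤ A ^ 2 - 17 * A + 87 := by
  have h1 : ∑ p, weight x p = ∑ l, (5 * defect x l - defect x l ^ 2) := by
    have := sum_mul_sum_comm (fun _ => 1) (defect x) x
    simp only [one_mul, size] at this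
    simp only [weight, ← this]
    exact Finset.sum_congr rfl fun l _ => by ring
  have h2 : ∑ p, (4 * excess x p + A - 6) ≤ ∑ p, weight x p :=
    Finset.sum_le_sum fun p _ => h.le_weight p
  simp only [Finset.sum_sub_distrib, Finset.sum_add_distrib, ← Finset.mul_sum, h.sum_excess,
    h.sum_defect, Finset.sum_const, Finset.card_univ, nsmul_eq_mul, h.card_points] at h1 h2
  linarith

lemma sum_excess_cubic_nonneg (h : IsDensePlane x A) :
    0 ≤ ∑ p, excess x p * (excess x p - 1) * (excess x p - 6) + (90 - 14 * A) := by
  have h0 : 0 ≤ ∑ l, (load x l - defect x l - 1) * (load x l - defect x l - 2) :=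
    Finset.sum_nonneg fun l _ => by
      rcases le_or_gt (load x l - defect x l) 1 with h | h
      · exact mul_nonneg_of_nonpos_of_nonpos (by omega) (by omega)
      · exact mul_nonneg (by omega) (by omega)
  have e : ∑ l, (load x l - defect x l - 1) * (load x l - defect x l - 2) =
      ∑ l, load x l ^ 2 - 2 * ∑ l, defect x l * load x l + ∑ l, defect x l ^ 2
        - 3 * ∑ l, load x l + 3 * ∑ l, defect x l + ∑ _l : β, 2 := by
    simp only [Finset.mul_sum, ← Finset.sum_add_distrib, ← Finset.sum_sub_distrib]
    exact Finset.sum_congr rfl fun l _ => by ring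
  have h1 := h.sum_load_sq_le
  have h2 := h.le_sum_defect_mul_load
  have h3 := h.sum_defect_sq_le
  have e2 : ∑ p, excess x p * (excess x p - 1) * (excess x p - 6) =
      ∑ p, excess x p * (excess x p * (4 + excess x p))
        - 2 * ∑ p, excess x p * (4 * excess x p + A - 6)
        - 3 * ∑ p, excess x p * (5 + excess x p) + (9 + 2 * A) * ∑ p, excess x p := by
    simp only [Finset.mul_sum, ← Finset.sum_add_distrib, ← Finset.sum_sub_distrib]
    exact Finset.sum_congr rfl fun l _ => by ring
  rw [e, sum_load, h.sum_defect] at h0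
  rw [e2, h.sum_excess]
  simp only [Finset.sum_const, Finset.card_univ, h.card_lines, nsmul_eq_mul] at h0
  push_cast at h0
  linarith

lemma excess_eq_zero_or_one (h : IsDensePlane x A) (hA : A = 5 ∨ A = 6) (p : α) :
    excess x p = 0 ∨ excess x p = 1 := by
  have h0 := h.excess_nonneg
  have hle : ∀ q, 4 * excess x q + A - 6 ≤ 4 * A - 15 :=
    fun q => (h.le_weight q).trans (h.weight_le q)
  have hp0 := h0 p
  have hpl := hle p
  rcases hA with rfl | rfl
  · omega
  by_contra hne
  have hp : excess x p = 2 := by omega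
  have h1 := h.sum_excess_cubic_nonneg
  have h2 : ∑ q, excess x q * (excess x q - 1) * (excess x q - 6) ≤
      excess x p * (excess x p - 1) * (excess x p - 6) := by
    classical
    rw [← Finset.add_sum_erase univ _ (mem_univ p)]
    have : ∑ q ∈ univ.erase p, excess x q * (excess x q - 1) * (excess x q - 6) ≤ 0 :=
      Finset.sum_nonpos fun q _ => by
        have hq0 := h0 q
        have hq : excess x q ≤ 2 := by have := hle q; omega
        interval_cases excess x q <;> norm_num
    linarith
  rw [hp] at h2
  linarith

lemma load_le_size (h : IsDensePlane x A) (hA : A = 5 ∨ A = 6) (l : β) :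
    load x l ≤ 5 - defect x l := by
  rw [← size, load]
  refine Finset.sum_le_sum fun p _ => ?_
  have := h.nonneg p l
  rcases h.excess_eq_zero_or_one hA p with h1 | h1 <;> simp [h1, this]

lemma four_lt (h : IsDensePlane x A) (hA : 0 < A) : 4 < A := by
  by_contra hle
  obtain ⟨p, -, hp⟩ : ∃ p ∈ univ, 0 < excess x p := by
    apply Finset.exists_lt_of_sum_lt
    simpa [h.sum_excess] using hA
  have h1 := h.le_weight p
  have h2 := h.weight_le p
  omega

lemma ne_seven (h : IsDensePlane x A) : A ≠ 7 := by
  rintro rfl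
  have h1 := h.sum_excess_cubic_nonneg
  have : ∑ q, excess x q * (excess x q - 1) * (excess x q - 6) ≤ 0 :=
    Finset.sum_nonpos fun q _ => by
      have hq0 := h.excess_nonneg q
      have hq : excess x q ≤ 3 := by
        have := h.le_weight q
        have := h.weight_le q
        omega
      interval_cases excess x q <;> norm_num
  linarith

lemma ne_five (h : IsDensePlane x A) : A ≠ 5 := by
  rintro rfl
  have h01 := h.excess_eq_zero_or_one (.inl rfl)
  set T : β → ℤ := fun l => if 3 ≤ load x l then 1 else 0 with hT
  have hT01 : ∀ l, T l = 0 ∨ T l = 1 := fun l => by by_cases h : 3 ≤ load x l <;> simp [hT, h]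
  have hT0 : ∀ l, 0 ≤ T l := fun l => by rcases hT01 l with h | h <;> omega
  have hQ : ∀ c d : ℤ, ∑ p, excess x p * (c * excess x p + d) = 5 * (c + d) := fun c d => by
    rw [← h.sum_excess, Finset.sum_mul]
    exact Finset.sum_congr rfl fun p _ => by rcases h01 p with h | h <;> rw [h] <;> ring
  have hQ' : ∑ p, excess x p * (excess x p * (4 + excess x p)) = 25 := by
    calc _ = ∑ p, excess x p * 5 :=
          Finset.sum_congr rfl fun p _ => by rcases h01 p with h | h <;> rw [h] <;> ring
      _ = 25 := by rw [← Finset.sum_mul, h.sum_excess]; norm_num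
  have hS : ∑ l, load x l = 30 := by
    have := hQ 1 5
    rw [sum_load]
    simpa [add_comm] using this
  have hS2 : ∑ l, load x l ^ 2 ≤ 50 := by
    have := h.sum_load_sq_le
    rw [hQ'] at this
    linarith
  have hwS : 15 ≤ ∑ l, defect x l * load x l := by
    have := hQ 4 (-1)
    refine le_trans (le_of_eq ?_) h.le_sum_defect_mul_load
    rw [← show 5 * (4 + -1) = (15 : ℤ) by norm_num, ← this]
    exact Finset.sum_congr rfl fun p _ => by ring
  have hlow : 3 ≤ ∑ l, T l := by
    have h1 : ∑ l, defect x l * load x l ≤ ∑ l, (2 * defect x l + 2 * T l) := by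
      refine Finset.sum_le_sum fun l _ => ?_
      have h1 := h.defect_nonneg l
      have h2 := h.load_nonneg l
      have h3 := h.load_le_size (.inl rfl) l
      have h4 : load x l ≤ 5 := by omega
      have h5 : defect x l ≤ 5 := by omega
      simp only [hT]
      generalize load x l = S at *
      generalize defect x l = w at *
      interval_cases S <;> interval_cases w <;> simp_all
    rw [Finset.sum_add_distrib, ← Finset.mul_sum, ← Finset.mul_sum, h.sum_defect] at h1
    omega
  have hhigh : ∑ l, T l ≤ 4 := by
    have h1 : ∑ l, 2 * T l ≤ ∑ l, (load x l ^ 2 - 3 * load x l + 2) := by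
      refine Finset.sum_le_sum fun l _ => ?_
      have h2 := h.load_nonneg l
      have h4 : load x l ≤ 5 := by
        have := h.load_le_size (.inl rfl) l
        have := h.defect_nonneg l
        omega
      simp only [hT]
      generalize load x l = S at *
      interval_cases S <;> simp
    rw [Finset.sum_add_distrib, Finset.sum_sub_distrib, ← Finset.mul_sum, ← Finset.mul_sum,
      hS] at h1
    simp only [Finset.sum_const, Finset.card_univ, h.card_lines, nsmul_eq_mul] at h1
    push_cast at h1
    omega
  set τ : α → ℤ := fun p => ∑ l, x p l * T l with hτ
  have hTS : 3 * ∑ l, T l ≤ ∑ l, T l * load x l := by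
    rw [Finset.mul_sum]
    refine Finset.sum_le_sum fun l _ => ?_
    by_cases h : 3 ≤ load x l <;> simp [hT, h]
  have hτ1 : ∑ p, excess x p * τ p = ∑ l, T l * load x l := (sum_mul_sum_comm _ T x).symm
  have hτ2 : ∑ p, excess x p * τ p ^ 2 ≤ ∑ l, T l * load x l + (∑ l, T l) ^ 2 - ∑ l, T l := by
    have h1 : ∀ l, T l * ∑ p, excess x p * x p l * τ p ≤ T l * (load x l + (∑ l', T l' - 1)) := by
      intro l
      have := (h.restrict h01).transpose.sum_mul_sum_le hT0 l
      have e : ∑ p, excess x p * x p l * ∑ l', T l' * (excess x p * x p l') =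
          ∑ p, excess x p * x p l * τ p := by
        refine Finset.sum_congr rfl fun p _ => ?_
        rcases h01 p with h | h <;> simp [h, hτ, mul_comm]
      rw [e] at this
      rcases hT01 l with h | h
      · simp [h]
      · rw [h] at this ⊢
        unfold load
        linarith
    have h2 := Finset.sum_le_sum fun l (_ : l ∈ univ) => h1 l
    have e1 : ∑ l, T l * ∑ p, excess x p * x p l * τ p = ∑ p, excess x p * τ p ^ 2 := by
      have := sum_mul_sum_comm (fun p => excess x p * τ p) T x
      calc _ = ∑ l, T l * ∑ p, excess x p * τ p * x p l := by
            refine Finset.sum_congr rfl fun l _ => ?_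
            congr 1
            exact Finset.sum_congr rfl fun p _ => by ring
        _ = _ := by
            rw [this]
            exact Finset.sum_congr rfl fun p _ => by simp only [hτ]; ring
    have e2 : ∑ l, T l * (load x l + (∑ l', T l' - 1)) =
        ∑ l, T l * load x l + (∑ l, T l) * (∑ l, T l - 1) := by
      simp only [mul_add, Finset.sum_add_distrib, ← Finset.sum_mul]
    rw [e1, e2] at h2
    linarith
  have hτ3 : 0 ≤ ∑ p, excess x p * ((τ p - 1) * (τ p - 2)) := by
    refine Finset.sum_nonneg fun p _ => mul_nonneg (h.excess_nonneg p) ?_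
    rcases le_or_gt (τ p) 1 with h | h
    · exact mul_nonneg_of_nonpos_of_nonpos (by omega) (by omega)
    · exact mul_nonneg (by omega) (by omega)
  have e3 : ∑ p, excess x p * ((τ p - 1) * (τ p - 2)) =
      ∑ p, excess x p * τ p ^ 2 - 3 * ∑ p, excess x p * τ p + 2 * ∑ p, excess x p := by
    simp only [Finset.mul_sum, ← Finset.sum_add_distrib, ← Finset.sum_sub_distrib]
    exact Finset.sum_congr rfl fun l _ => by ring
  rw [e3, h.sum_excess, hτ1] at hτ3
  rw [hτ1] at *
  generalize ∑ l, T l = t at *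
  interval_cases t <;> omega

lemma ne_six (h : IsDensePlane x A) : A ≠ 6 := by
  rintro rfl
  have h01 := h.excess_eq_zero_or_one (.inr rfl)
  have hQ : ∀ f : ℤ → ℤ, ∑ p, excess x p * f (excess x p) = 6 * f 1 := fun f => by
    rw [← h.sum_excess, Finset.sum_mul]
    exact Finset.sum_congr rfl fun p _ => by rcases h01 p with h | h <;> simp [h]
  have hS : ∑ l, load x l = 36 := by
    rw [sum_load]
    exact hQ fun a => 5 + a
  have hS2 : ∑ l, load x l ^ 2 ≤ 66 := by
    have := h.sum_load_sq_le
    rw [hQ fun a => a * (4 + a)] at this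
    linarith
  have hwS : 24 ≤ ∑ l, defect x l * load x l := by
    have := h.le_sum_defect_mul_load
    rw [hQ fun a => 4 * a + 6 - 6] at this
    linarith
  have hw := h.sum_defect
  have hrange : ∀ l, 0 ≤ load x l ∧ load x l ≤ 5 ∧ 0 ≤ defect x l ∧ defect x l ≤ 5 ∧
      load x l ≤ 5 - defect x l := fun l => by
    have h1 := h.defect_nonneg l
    have h2 := h.load_nonneg l
    have h3 := h.load_le_size (.inr rfl) l
    omega
  have hterm : ∀ l, 0 ≤ load x l ^ 2 - 3 * load x l + 2 - defect x l * load x l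
      + 2 * defect x l := fun l => by
    obtain ⟨h1, h2, h3, h4, h5⟩ := hrange l
    generalize load x l = S at *
    generalize defect x l = w at *
    interval_cases S <;> interval_cases w <;> simp_all
  have hsum : ∑ l, (load x l ^ 2 - 3 * load x l + 2 - defect x l * load x l + 2 * defect x l) =
      ∑ l, load x l ^ 2 - ∑ l, defect x l * load x l - 42 := by
    simp only [Finset.sum_add_distrib, Finset.sum_sub_distrib, ← Finset.mul_sum, hS, hw,
      Finset.sum_const, Finset.card_univ, h.card_lines, nsmul_eq_mul]
    push_cast
    ring
  have hsum0 := Finset.sum_nonneg fun l (_ : l ∈ univ) => hterm l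
  have hS2' : ∑ l, load x l ^ 2 = 66 := by omega
  have hwS' : ∑ l, defect x l * load x l = 24 := by omega
  have htight : ∀ l, load x l = 1 ∧ defect x l = 0 ∨ load x l = 2 ∨
      load x l = 3 ∧ defect x l = 2 := fun l => by
    have h0 := (Finset.sum_eq_zero_iff_of_nonneg fun l (_ : l ∈ univ) => hterm l).1
      (by rw [hsum]; omega) l (mem_univ l)
    obtain ⟨h1, h2, h3, h4, h5⟩ := hrange l
    generalize load x l = S at *
    generalize defect x l = w at *
    interval_cases S <;> interval_cases w <;> simp_all
  have hjoin : ∀ p, excess x p = 1 → ∑ l, x p l * load x l = 11 := fun p hp => by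
    have h1 : ∀ q ∈ univ, 0 ≤ excess x q * (11 - ∑ l, x q l * load x l) := fun q _ => by
      have := h.sum_mul_load_le q
      rcases h01 q with h | h <;> rw [h] at this ⊢ <;> linarith
    have h2 : ∑ q, excess x q * (11 - ∑ l, x q l * load x l) = 0 := by
      simp only [mul_sub, Finset.sum_sub_distrib, ← Finset.sum_mul, h.sum_excess, ← sum_load_sq,
        hS2']
      norm_num
    have h3 := (Finset.sum_eq_zero_iff_of_nonneg h1).1 h2 p (mem_univ p)
    rw [hp] at h3
    linarith
  have hweight : ∀ p, excess x p = 1 → weight x p = 4 := fun p hp => by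
    have h1 : ∀ q ∈ univ, 0 ≤ excess x q * (weight x q - 4) := fun q _ => by
      have := h.le_weight q
      rcases h01 q with h | h <;> rw [h] at this ⊢ <;> linarith
    have h2 : ∑ q, excess x q * (weight x q - 4) = 0 := by
      simp only [mul_sub, Finset.sum_sub_distrib, ← Finset.sum_mul, h.sum_excess,
        ← sum_defect_mul_load, hwS']
      norm_num
    have h3 := (Finset.sum_eq_zero_iff_of_nonneg h1).1 h2 p (mem_univ p)
    rw [hp] at h3
    linarith
  set T : β → ℤ := fun l => if load x l = 3 then 1 else 0 with hT
  set B : β → ℤ := fun l => if load x l = 2 then 1 else 0 with hB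
  have hload : ∀ l, load x l = 1 + B l + 2 * T l := fun l => by
    rcases htight l with ⟨h, -⟩ | h | ⟨h, -⟩ <;> simp [hT, hB, h]
  have hdefect : ∀ l, defect x l = 2 * T l + defect x l * B l := fun l => by
    rcases htight l with ⟨h, h'⟩ | h | ⟨h, h'⟩
    · simp [hT, h, h']
    · simp [hT, hB, h]
    · simp [hT, hB, h, h']
  have hB01 : ∀ l, B l = 0 ∨ B l = 1 := fun l => by by_cases h : load x l = 2 <;> simp [hB, h]
  have hT0 : ∀ l, 0 ≤ T l := fun l => by by_cases h : load x l = 3 <;> simp [hT, h]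
  have hwB0 : ∀ l, 0 ≤ defect x l * B l := fun l => by
    rcases hB01 l with h' | h' <;> simp [h', h.defect_nonneg]
  have hsumT : ∑ l, T l = 3 := by
    have e : ∑ l, (load x l ^ 2 - 3 * load x l + 2) = ∑ l, 2 * T l :=
      Finset.sum_congr rfl fun l _ => by
        rcases htight l with ⟨h, -⟩ | h | ⟨h, -⟩ <;> simp [hT, h]
    simp only [Finset.sum_add_distrib, Finset.sum_sub_distrib, ← Finset.mul_sum, hS, hS2',
      Finset.sum_const, Finset.card_univ, h.card_lines, nsmul_eq_mul] at e
    push_cast at e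
    omega
  have hsumB : ∑ l, B l = 6 := by
    have e := Finset.sum_congr rfl fun l (_ : l ∈ univ) => hload l
    simp only [Finset.sum_add_distrib, ← Finset.mul_sum, hS, hsumT, Finset.sum_const,
      Finset.card_univ, h.card_lines, nsmul_eq_mul] at e
    push_cast at e
    omega
  have hsumwB : ∑ l, defect x l * B l = 3 := by
    have e := Finset.sum_congr rfl fun l (_ : l ∈ univ) => hdefect l
    rw [Finset.sum_add_distrib, ← Finset.mul_sum, hsumT, hw] at e
    omega
  set τ : α → ℤ := fun p => ∑ l, x p l * T l with hτ
  set σ : α → ℤ := fun p => ∑ l, x p l * B l with hσ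
  have hpencil : ∀ p, ∑ l, x p l * load x l = 5 + excess x p + σ p + 2 * τ p := fun p => by
    rw [← degree, hσ, hτ, Finset.mul_sum, ← Finset.sum_add_distrib, ← Finset.sum_add_distrib]
    exact Finset.sum_congr rfl fun l _ => by rw [hload l]; ring
  have hwt : ∀ p, weight x p = 2 * τ p + ∑ l, x p l * (defect x l * B l) := fun p => by
    rw [hτ, Finset.mul_sum, ← Finset.sum_add_distrib, weight]
    exact Finset.sum_congr rfl fun l _ => by linear_combination x p l * hdefect l
  have hwB : ∀ p, 0 ≤ ∑ l, x p l * (defect x l * B l) := fun p =>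
    Finset.sum_nonneg fun l _ => mul_nonneg (h.nonneg p l) (hwB0 l)
  have hσ_le : ∀ p, σ p ≤ 1 + 2 * excess x p := fun p => by
    rcases h01 p with hp | hp
    · have h1 := h.sum_mul_load_le p
      have h2 : 0 ≤ τ p := Finset.sum_nonneg fun l _ => mul_nonneg (h.nonneg p l) (hT0 l)
      rw [hpencil, hp] at h1
      rw [hp]
      linarith
    · have h1 := hjoin p hp
      have h2 := hweight p hp
      have h3 : ∑ l, x p l * (defect x l * B l) ≤ 3 := by
        rw [← hsumwB]
        refine Finset.sum_le_sum fun l _ => ?_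
        have := hwB0 l
        rcases h.zero_or_one p l with h1 | h1 <;> simp [h1, this]
      rw [hpencil, hp] at h1
      rw [hwt] at h2
      omega
  obtain ⟨u, hu, hτu⟩ : ∃ u, excess x u = 1 ∧ 2 ≤ τ u := by
    by_contra! hcon
    have h1 : ∑ p, excess x p * τ p = 9 := by
      have e : ∑ l, T l * load x l = ∑ p, excess x p * τ p := sum_mul_sum_comm _ T x
      rw [← e, show (9 : ℤ) = (∑ l, T l) * 3 by rw [hsumT]; norm_num, Finset.sum_mul]
      refine Finset.sum_congr rfl fun l _ => ?_
      by_cases h : load x l = 3 <;> simp [hT, h]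
    have h2 : ∑ p, excess x p * τ p ≤ ∑ p, excess x p := by
      refine Finset.sum_le_sum fun p _ => ?_
      rcases h01 p with hp | hp
      · simp [hp]
      · have := hcon p hp
        rw [hp]
        omega
    rw [h1, h.sum_excess] at h2
    omega
  have hwtu := hweight u hu
  have hju := hjoin u hu
  have hwBu := hwB u
  rw [hwt] at hwtu
  rw [hpencil, hu] at hju
  have hσu : σ u = 1 := by omega
  have hwBu0 : ∑ l, x u l * (defect x l * B l) = 0 := by omega
  obtain ⟨m, -, hm⟩ : ∃ m ∈ univ, x u m * B m ≠ 0 :=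
    Finset.exists_ne_zero_of_sum_ne_zero (hσu.trans_ne one_ne_zero)
  have hxm : x u m = 1 := (h.zero_or_one u m).resolve_left fun h => hm (by simp [h])
  have hBm : B m = 1 := (hB01 m).resolve_left fun h => hm (by simp [h])
  have hloadm : load x m = 2 := by
    by_contra hne
    simp [hB, hne] at hBm
  have hdm : defect x m = 0 := by
    have := (Finset.sum_eq_zero_iff_of_nonneg fun l _ =>
      mul_nonneg (h.nonneg u l) (hwB0 l)).1 hwBu0 m (mem_univ m)
    simpa [hxm, hBm] using this
  set κ : β → ℤ := fun l => ∑ p, x p m * x p l with hκ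
  have hκm : κ m = 5 := by
    rw [hκ]
    simp only [h.mul_self]
    rw [size, hdm]
    norm_num
  have hκsum : ∑ l, κ l = 27 := by
    have := sum_mul_degree (x := x) m
    rw [hdm, hloadm] at this
    simp only [Finset.mul_sum] at this
    rw [hκ, Finset.sum_comm]
    linarith
  have hκB : ∑ l, B l * κ l ≤ 7 := by
    classical
    have e : ∑ l, B l * κ l = ∑ p, x p m * σ p := sum_mul_sum_comm (fun p => x p m) B x
    have h1 : ∑ p, x p m * (1 + 2 * excess x p) = 9 := by
      have e1 : ∑ p, x p m * (1 + 2 * excess x p) = ∑ p, x p m + 2 * load x m := by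
        rw [load, Finset.mul_sum, ← Finset.sum_add_distrib]
        exact Finset.sum_congr rfl fun p _ => by ring
      rw [e1, size, hdm, hloadm]
      norm_num
    have h2 : ∑ p ∈ univ.erase u, x p m * σ p ≤ ∑ p ∈ univ.erase u, x p m * (1 + 2 * excess x p) :=
      Finset.sum_le_sum fun p _ => mul_le_mul_of_nonneg_left (hσ_le p) (h.nonneg p m)
    rw [← Finset.add_sum_erase univ _ (mem_univ u), hxm, hu] at h1
    rw [e, ← Finset.add_sum_erase univ _ (mem_univ u), hxm, hσu]
    linarith
  have hfinal : 0 ≤ ∑ l, (1 - B l) * (1 - κ l) := by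
    refine Finset.sum_nonneg fun l _ => ?_
    by_cases hl : l = m
    · simp [hl, hBm]
    · have h1 : κ l ≤ 1 := h.transpose.sum_mul_le_one (Ne.symm hl)
      have h2 : B l ≤ 1 := by rcases hB01 l with h | h <;> omega
      exact mul_nonneg (by omega) (by omega)
  have e : ∑ l, (1 - B l) * (1 - κ l) = ∑ _l : β, 1 - ∑ l, B l - ∑ l, κ l + ∑ l, B l * κ l := by
    simp only [← Finset.sum_add_distrib, ← Finset.sum_sub_distrib]
    exact Finset.sum_congr rfl fun l _ => by ring
  rw [e, hsumB, hκsum] at hfinal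
  simp only [Finset.sum_const, Finset.card_univ, h.card_lines, nsmul_eq_mul] at hfinal
  push_cast at hfinal
  linarith

end IsDensePlane

namespace IsPartialPlane

lemma total_le_of_card_eq_nineteen {x : α → β → ℤ} (h : IsPartialPlane x)
    (hα : Fintype.card α = 19) (hβ : Fintype.card β = 24) : ∑ p, ∑ l, x p l ≤ 102 := by
  have h1 := Finset.sum_le_sum fun p (_ : p ∈ univ) => h.sum_mul_size_le p
  have e : ∑ l, (∑ q, x q l) * ∑ p, x p l = ∑ p, ∑ l, x p l * ∑ q, x q l := by
    simpa using sum_mul_sum_comm (fun _ => 1) (fun l => ∑ q, x q l) x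
  have h2 : 0 ≤ ∑ l, (∑ q, x q l - 4) * (∑ q, x q l - 5) := by
    refine Finset.sum_nonneg fun l _ => ?_
    rcases le_or_gt (∑ q, x q l) 4 with h | h
    · exact mul_nonneg_of_nonpos_of_nonpos (by omega) (by omega)
    · exact mul_nonneg (by omega) (by omega)
  have e2 : ∑ l, (∑ q, x q l - 4) * (∑ q, x q l - 5) =
      ∑ l, (∑ q, x q l) * ∑ p, x p l - 9 * ∑ l, ∑ q, x q l + ∑ _l : β, 20 := by
    rw [Finset.mul_sum, ← Finset.sum_sub_distrib, ← Finset.sum_add_distrib]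
    exact Finset.sum_congr rfl fun l _ => by ring
  rw [e2, e, Finset.sum_comm (f := fun l q => x q l)] at h2
  rw [Finset.sum_add_distrib] at h1
  simp only [Finset.sum_const, Finset.card_univ, hα, hβ, nsmul_eq_mul] at h1 h2
  push_cast at h1 h2
  omega

theorem total_le (hβ : Fintype.card β = 24) (n : ℕ) (hn : n ≤ 5) :
    ∀ {α : Type} [Fintype α] {x : α → β → ℤ}, IsPartialPlane x → Fintype.card α = 19 + n →
      ∑ p, ∑ l, x p l ≤ 102 + 4 * n := by
  classical
  induction n with
  | zero =>
    intro α _ x h hα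
    simpa using h.total_le_of_card_eq_nineteen hα hβ
  | succ n ih =>
    intro α _ x h hα
    by_contra hlt
    obtain ⟨y, hy, htot⟩ := h.exists_total_eq (e := 103 + 4 * (n + 1)) (by push_cast at *; omega)
    push_cast at htot
    by_cases hdeg : ∀ p, 0 ≤ excess y p
    · have hd : IsDensePlane y (7 - n) :=
        { hy with
          card_points := by rw [hα]; push_cast; ring
          card_lines := hβ
          total := by rw [htot]; ring
          excess_nonneg := hdeg }
      have h4 := hd.four_lt (by omega)
      have h5 := hd.ne_five
      have h6 := hd.ne_six
      have h7 := hd.ne_seven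
      omega
    · push Not at hdeg
      obtain ⟨p, hp⟩ := hdeg
      have hsub : IsPartialPlane fun (q : {q // q ≠ p}) l => y q l :=
        ⟨fun q l => hy.zero_or_one q l,
          fun q r l l' hqr hl => hy.rect q r l l' (Subtype.coe_injective.ne hqr) hl⟩
      have h1 := ih (by omega) hsub (by simp [Fintype.card_subtype_compl, hα])
      rw [Fintype.sum_eq_add_sum_subtype_ne _ p] at htot
      unfold excess at hp
      omega

end IsPartialPlane

end PartialPlane

/-- A perfect difference set modulo `31`: its translates are the lines of the projective plane of
order `5`. -/
def planarDifferenceSet : Finset ℤ := {1, 5, 11, 24, 25, 27}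

/-- The points outside a complete quadrilateral and its three diagonal points. -/
def remainingPoints : Fin 24 → ℤ :=
  ![4, 6, 7, 8, 10, 12, 13, 14, 15, 16, 17, 18, 19, 20, 21, 22, 23, 24, 25, 26, 27, 28, 29, 30]

/-- The lines other than the six lines of the quadrangle and one diagonal. -/
def remainingLines : Fin 24 → ℤ :=
  ![1, 2, 3, 5, 11, 12, 13, 14, 15, 16, 17, 18, 19, 20, 21, 22, 23, 24, 25, 26, 27, 28, 29, 30]

/-- Incidence of the remaining points and lines of the projective plane of order `5`. -/
def remainingIncidence (i j : Fin 24) : Bool :=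
  decide ((remainingPoints i - remainingLines j) % 31 ∈ planarDifferenceSet)

lemma planarDifferenceSet_sub_eq : ∀ a ∈ planarDifferenceSet, ∀ b ∈ planarDifferenceSet,
    ∀ c ∈ planarDifferenceSet, ∀ d ∈ planarDifferenceSet,
      (a - b - (c - d)) % 31 = 0 → a = b ∨ a = c := by
  decide +kernel

lemma remainingPoints_injective :
    ∀ i j, (remainingPoints i - remainingPoints j) % 31 = 0 → i = j := by
  decide +kernel

lemma remainingLines_injective :
    ∀ i j, (remainingLines i - remainingLines j) % 31 = 0 → i = j := by
  decide +kernel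

lemma admissible_remainingIncidence : Admissible 2 2 remainingIncidence := by
  rintro ⟨R, C, hR, hC, h⟩
  obtain ⟨p, q, hpq, rfl⟩ := Finset.card_eq_two.1 hR
  obtain ⟨l, m, hlm, rfl⟩ := Finset.card_eq_two.1 hC
  simp only [remainingIncidence, Finset.mem_insert, Finset.mem_singleton, forall_eq_or_imp,
    forall_eq, decide_eq_true_eq] at h
  obtain ⟨⟨h1, h2⟩, h3, h4⟩ := h
  rcases planarDifferenceSet_sub_eq _ h1 _ h2 _ h3 _ h4 (by omega) with h | h
  · exact hlm (remainingLines_injective _ _ (by omega))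
  · exact hpq (remainingPoints_injective _ _ (by omega))

lemma onesCount_remainingIncidence : onesCount remainingIncidence = 122 := by
  decide +kernel

lemma onesCount_le {M : Fin 24 → Fin 24 → Bool} (hM : Admissible 2 2 M) : onesCount M ≤ 122 := by
  have h : IsPartialPlane fun i j => if M i j = true then (1 : ℤ) else 0 := by
    refine ⟨fun p l => ?_, fun p q l m hpq hlm => ?_⟩
    · cases M p l <;> simp
    · by_contra hne
      simp only [mul_eq_zero, ite_eq_right_iff, one_ne_zero, imp_false, not_or, not_not] at hne
      exact hM ⟨{p, q}, {l, m}, Finset.card_pair hpq, Finset.card_pair hlm, by simp [hne]⟩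
  have h1 := IsPartialPlane.total_le (by simp) 5 le_rfl h (by simp)
  rw [← Fintype.sum_prod_type' (f := fun i j => if M i j = true then (1 : ℤ) else 0),
    ← Finset.natCast_card_filter] at h1
  exact_mod_cast h1

/-- `z_2(24, 24) = 122`. -/
theorem stmt17 :
    (∃ M : Fin 24 → Fin 24 → Bool, Admissible 2 2 M ∧ onesCount M = 122) ∧
      ∀ M : Fin 24 → Fin 24 → Bool, Admissible 2 2 M → onesCount M ≤ 122 :=
  ⟨⟨remainingIncidence, admissible_remainingIncidence, onesCount_remainingIncidence⟩,
    fun _ => onesCount_le⟩
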